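/- At every τ with φ(τ,−γ) ≠ 0, the function r(τ) = φ(τ,γ)/φ(τ,−γ) is differentiable with derivative r′(τ) = 2·(1+γ²)·sin τ·(sinh(γ·τ) − γ·sin τ)/φ(τ,−γ)². In particular, if γ > 0 then r is strictly decreasing on any subinterval of (π, 2π) where φ(τ,−γ) ≠ 0. -/

import Mathlib

/-- The auxiliary function of Lemma 3.1: `φ(x,y) = 1 − exp(x·y)·(cos x − y·sin x)`. -/
noncomputable def phi (x y : ℝ) : ℝ :=
  1 - Real.exp (x * y) * (Real.cos x - y * Real.sin x)

/-- The slope quotient `r(τ) = φ(τ,γ)/φ(τ,−γ)` of the Poincaré half-return map. -/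
noncomputable def rMap (γ τ : ℝ) : ℝ := phi τ γ / phi τ (-γ)

theorem hasDerivAt_phi (x y : ℝ) :
    HasDerivAt (fun t => phi t y) (Real.exp (x * y) * (1 + y ^ 2) * Real.sin x) x := by
  have hexp : HasDerivAt (fun t => Real.exp (t * y)) (Real.exp (x * y) * (1 * y)) x :=
    ((hasDerivAt_id x).mul_const y).exp
  have htrig : HasDerivAt (fun t => Real.cos t - y * Real.sin t)
      (-Real.sin x - y * Real.cos x) x :=
    (Real.hasDerivAt_cos x).sub ((Real.hasDerivAt_sin x).const_mul y)
  refine ((hexp.mul htrig).const_sub 1).congr_deriv ?_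
  ring

theorem hasDerivAt_rMap (γ τ : ℝ) (hτ : phi τ (-γ) ≠ 0) :
    HasDerivAt (rMap γ)
      (2 * (1 + γ ^ 2) * Real.sin τ * (Real.sinh (γ * τ) - γ * Real.sin τ) /
        phi τ (-γ) ^ 2) τ := by
  refine ((hasDerivAt_phi τ γ).div (hasDerivAt_phi τ (-γ)) hτ).congr_deriv ?_
  congr 1
  have hexp : Real.exp (τ * γ) * Real.exp (τ * -γ) = 1 := by
    rw [← Real.exp_add, mul_neg, add_neg_cancel, Real.exp_zero]
  rw [Real.sinh_eq, mul_comm γ τ, ← mul_neg, phi, phi]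
  linear_combination (-2 * γ * (1 + γ ^ 2) * Real.sin τ ^ 2) * hexp

theorem strictAntiOn_rMap {γ : ℝ} (hγ : 0 < γ) {s : Set ℝ}
    (hs : s ⊆ Set.Ioo Real.pi (2 * Real.pi)) (hconn : s.OrdConnected)
    (hphi : ∀ τ ∈ s, phi τ (-γ) ≠ 0) : StrictAntiOn (rMap γ) s := by
  refine strictAntiOn_of_deriv_neg hconn.convex
    (fun τ hτ => (hasDerivAt_rMap γ τ (hphi τ hτ)).continuousAt.continuousWithinAt) ?_
  intro τ hτ
  have hmem := interior_subset hτ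
  obtain ⟨hlt, hgt⟩ := hs hmem
  have hne := hphi τ hmem
  rw [(hasDerivAt_rMap γ τ hne).deriv]
  have hsin : Real.sin τ < 0 := by
    rw [← Real.sin_sub_two_pi]
    exact Real.sin_neg_of_neg_of_neg_pi_lt (by linarith) (by linarith)
  have hsinh : 0 < Real.sinh (γ * τ) :=
    Real.sinh_pos_iff.mpr (mul_pos hγ (Real.pi_pos.trans hlt))
  have hdiff : 0 < Real.sinh (γ * τ) - γ * Real.sin τ := by
    linarith [mul_neg_of_pos_of_neg hγ hsin]
  exact div_neg_of_neg_of_pos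
    (mul_neg_of_neg_of_pos (mul_neg_of_pos_of_neg (by positivity) hsin) hdiff) (by positivity)

/-- At every `τ` with `φ(τ,−γ) ≠ 0`, the quotient `r(τ) = φ(τ,γ)/φ(τ,−γ)` is
differentiable with derivative
`r′(τ) = 2·(1+γ²)·sin τ·(sinh(γ·τ) − γ·sin τ)/φ(τ,−γ)²`; in particular, if `γ > 0`
then `r` is strictly decreasing on any subinterval of `(π, 2π)` where `φ(τ,−γ) ≠ 0`. -/
theorem stmt_12 (γ : ℝ) :
    (∀ τ : ℝ, phi τ (-γ) ≠ 0 →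
      HasDerivAt (rMap γ)
        (2 * (1 + γ ^ 2) * Real.sin τ * (Real.sinh (γ * τ) - γ * Real.sin τ) /
          phi τ (-γ) ^ 2) τ) ∧
    (0 < γ → ∀ s : Set ℝ, s ⊆ Set.Ioo Real.pi (2 * Real.pi) → s.OrdConnected →
      (∀ τ ∈ s, phi τ (-γ) ≠ 0) → StrictAntiOn (rMap γ) s) :=
  ⟨hasDerivAt_rMap γ, fun hγ _ hs hconn hphi => strictAntiOn_rMap hγ hs hconn hphi⟩
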